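/- The Harrison cochains form a subcomplex of the Hochschild cochain complex: let A be a commutative associative unital R-algebra. Say that f ∈ C^n(A,A) vanishes on shuffles if for every p with 1 ≤ p ≤ n−1 and all a_1,…,a_n ∈ A, Σ_{σ ∈ Sh(p, n−p)} sgn(σ) f(a_{σ^{−1}(1)},…,a_{σ^{−1}(n)}) = 0. If f ∈ C^n(A,A) vanishes on shuffles, then δf ∈ C^{n+1}(A,A) also vanishes on shuffles. -/

import Mathlib

variable {R A : Type} [CommRing R] [CommRing A] [Algebra R A]

/-- A Hochschild `n`-cochain, viewed as a function on sequences (only the first `n`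
entries of the sequence are relevant). -/
def toC {n : ℕ} (f : MultilinearMap R (fun _ : Fin n => A) A) : (ℕ → A) → A :=
  fun a => f (fun i => a i.val)

/-- The Hochschild differential `δ : C^n(A,A) → C^{n+1}(A,A)` (0-based indexing). -/
def hochδ (n : ℕ) (f : (ℕ → A) → A) : (ℕ → A) → A :=
  fun a =>
    a 0 * f (fun i => a (i + 1))
      + ∑ i ∈ Finset.range n, ((-1 : ℤ) ^ (i + 1)) •
          f (fun j => if j < i then a j else if j = i then a i * a (i + 1) else a (j + 1))
      + ((-1 : ℤ) ^ (n + 1)) • (f a * a n)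

/-- The sequence `(a_{σ⁻¹(1)}, …, a_{σ⁻¹(n)}, a_{n+1}, a_{n+2}, …)`: the first `n`
arguments are permuted by `σ⁻¹`, the rest are untouched. -/
def permuteArgs (n : ℕ) (σ : Equiv.Perm (Fin n)) (a : ℕ → A) : ℕ → A :=
  fun k => if h : k < n then a ((σ⁻¹ ⟨k, h⟩ : Fin n) : ℕ) else a k

/-- An `n`-cochain `f` vanishes on shuffles if for every `p, q ≥ 1` with `p + q = n`,
the signed sum over all `(p,q)`-shuffles `σ` (permutations increasing on the first `p`
and on the last `q` positions) of `f(a_{σ⁻¹(1)},…,a_{σ⁻¹(n)})` is zero. -/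
def VanishesOnShuffles (n : ℕ) (f : (ℕ → A) → A) : Prop :=
  ∀ p q : ℕ, p + q = n → 1 ≤ p → 1 ≤ q → ∀ a : ℕ → A,
    ∑ σ ∈ Finset.univ.filter (fun σ : Equiv.Perm (Fin n) =>
        (∀ i j : Fin n, (i : ℕ) < p → (j : ℕ) < p → i < j → σ i < σ j) ∧
        (∀ i j : Fin n, p ≤ (i : ℕ) → p ≤ (j : ℕ) → i < j → σ i < σ j)),
      ((Equiv.Perm.sign σ : ℤ)) • f (permuteArgs n σ a) = 0

/-- The signed sum of `F` over all shuffles of two lists. -/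
def signedShuffle (F : List A → A) : List A → List A → A
  | [], v => F v
  | a :: u, [] => F (a :: u)
  | a :: u, b :: v =>
      signedShuffle (fun w => F (a :: w)) u (b :: v) +
        (-1) ^ (u.length + 1) * signedShuffle (fun w => F (b :: w)) (a :: u) v
termination_by u v => u.length + v.length

/-- Multiply the first entry of a list by `a` before applying `F`. -/
def mulHead (a : A) (F : List A → A) : List A → A
  | [] => 0
  | b :: w => F (a * b :: w)

/-- The alternating sum of `F` over all lists obtained by multiplying two adjacent entries. -/
def barDiff (F : List A → A) : List A → A
  | [] => 0
  | a :: w => mulHead a F w - barDiff (fun x => F (a :: x)) w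

/-- The product of `F` at the initial segment of a list with the last entry. -/
def mulLast (F : List A → A) : List A → A
  | [] => 0
  | a :: w => if w = [] then F [] * a else mulLast (fun x => F (a :: x)) w

lemma signedShuffle_nil_right (F : List A → A) (u : List A) :
    signedShuffle F u [] = F u := by
  cases u <;> simp [signedShuffle]

lemma signedShuffle_cons_cons (F : List A → A) (a b : A) (u v : List A) :
    signedShuffle F (a :: u) (b :: v) =
      signedShuffle (fun w => F (a :: w)) u (b :: v) +
        (-1) ^ (u.length + 1) * signedShuffle (fun w => F (b :: w)) (a :: u) v := by
  rw [signedShuffle]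

lemma signedShuffle_congr {F G : List A → A} {u v : List A}
    (h : ∀ w, w.length = u.length + v.length → F w = G w) :
    signedShuffle F u v = signedShuffle G u v := by
  induction F, u, v using signedShuffle.induct generalizing G with
  | case1 F v => simpa [signedShuffle] using h v (by simp)
  | case2 F a u => simpa [signedShuffle] using h (a :: u) (by simp)
  | case3 F a u b v ih₁ ih₂ =>
    rw [signedShuffle, signedShuffle, ih₁, ih₂]
    · intro w hw; exact h _ (by simp at hw ⊢; omega)
    · intro w hw; exact h _ (by simp at hw ⊢; omega)

lemma signedShuffle_linear (c d : A) (F G : List A → A) (u v : List A) :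
    signedShuffle (fun w => c * F w + d * G w) u v =
      c * signedShuffle F u v + d * signedShuffle G u v := by
  induction F, u, v using signedShuffle.induct generalizing G with
  | case1 F v => simp [signedShuffle]
  | case2 F a u => simp [signedShuffle]
  | case3 F a u b v ih₁ ih₂ =>
    rw [signedShuffle, signedShuffle, signedShuffle, ih₁, ih₂]
    ring

lemma barDiff_congr {F G : List A → A} {u : List A}
    (h : ∀ w, w.length + 1 = u.length → F w = G w) : barDiff F u = barDiff G u := by
  induction u generalizing F G with
  | nil => rfl
  | cons a u ih =>
    rw [barDiff, barDiff, ih (G := fun x => G (a :: x))]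
    · cases u with
      | nil => rfl
      | cons b u => simp only [mulHead]; rw [h _ (by simp)]
    · intro w hw; exact h _ (by simp at hw ⊢; omega)

lemma barDiff_linear (c d : A) (F G : List A → A) (u : List A) :
    barDiff (fun w => c * F w + d * G w) u = c * barDiff F u + d * barDiff G u := by
  induction u generalizing F G with
  | nil => simp [barDiff]
  | cons a u ih =>
    rw [barDiff, barDiff, barDiff, ih]
    cases u <;> simp only [mulHead] <;> ring

lemma barDiff_eq_zero {F : List A → A} {u : List A}
    (h : ∀ w, w ≠ [] → w.length + 1 = u.length → F w = 0) : barDiff F u = 0 := by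
  match u with
  | [] => rfl
  | [a] => simp [barDiff, mulHead]
  | a :: b :: u =>
    have : barDiff F (a :: b :: u) = barDiff (fun w => 0 * F w + 0 * F w) (a :: b :: u) :=
      barDiff_congr fun w hw => by
        rw [h w (by rintro rfl; simp at hw) hw]; simp
    rw [this, barDiff_linear]; simp

/-- The mixed products in the bar differential of a shuffle cancel. -/
lemma signedShuffle_mulHead (F : List A → A) (a b : A) (u v : List A) :
    signedShuffle (mulHead a F) u (b :: v) +
        (-1) ^ (u.length + 1) * signedShuffle (mulHead b F) (a :: u) v =
      (mulHead a (fun x => signedShuffle F x (b :: v)) u -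
          (-1) ^ u.length * mulHead a (fun x => signedShuffle (fun w => F (b :: w)) x v) u) +
        (-1) ^ (u.length + 1) *
          (mulHead b (fun y => signedShuffle F (a :: u) y) v -
            mulHead b (fun y => signedShuffle (fun w => F (a :: w)) u y) v) := by
  rcases u with _ | ⟨c, u⟩ <;> rcases v with _ | ⟨d, v⟩ <;>
    simp [signedShuffle, mulHead, signedShuffle_nil_right, mul_comm b a] <;> ring

/-- The bar differential is a graded derivation of the signed shuffle product. -/
lemma signedShuffle_barDiff (F : List A → A) (u v : List A) :
    signedShuffle (barDiff F) u v =
      barDiff (fun x => signedShuffle F x v) u +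
        (-1) ^ u.length * barDiff (fun y => signedShuffle F u y) v := by
  induction F, u, v using signedShuffle.induct with
  | case1 F v => simp [signedShuffle, barDiff]
  | case2 F a u => simp [signedShuffle_nil_right, barDiff]
  | case3 F a u b v ih₁ ih₂ =>
    have split (c : A) (u v : List A) : signedShuffle (fun w => barDiff F (c :: w)) u v =
        signedShuffle (mulHead c F) u v -
          signedShuffle (barDiff fun w => F (c :: w)) u v := by
      have := signedShuffle_linear 1 (-1) (mulHead c F) (barDiff fun w => F (c :: w)) u v
      simpa [barDiff, sub_eq_add_neg] using this
    have hu : barDiff (fun x => signedShuffle F (a :: x) (b :: v)) u =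
        barDiff (fun x => signedShuffle (fun w => F (a :: w)) x (b :: v)) u +
          (-1) ^ u.length *
            barDiff (fun x => signedShuffle (fun w => F (b :: w)) (a :: x) v) u := by
      rw [← one_mul (barDiff (fun x => signedShuffle (fun w => F (a :: w)) x (b :: v)) u),
        ← barDiff_linear]
      refine barDiff_congr fun w hw => ?_
      rw [signedShuffle, hw, one_mul]
    have hv : barDiff (fun y => signedShuffle F (a :: u) (b :: y)) v =
        barDiff (fun y => signedShuffle (fun w => F (a :: w)) u (b :: y)) v +
          (-1) ^ (u.length + 1) *
            barDiff (fun y => signedShuffle (fun w => F (b :: w)) (a :: u) y) v := by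
      rw [← one_mul (barDiff (fun y => signedShuffle (fun w => F (a :: w)) u (b :: y)) v),
        ← barDiff_linear]
      refine barDiff_congr fun w hw => ?_
      rw [signedShuffle, one_mul]
    have hm := signedShuffle_mulHead F a b u v
    rw [signedShuffle, split, split, ih₁, ih₂]
    simp only [barDiff, hu, hv, List.length_cons, pow_succ] at hm ⊢
    linear_combination hm

lemma mulLast_cons {F : List A → A} {a : A} {w : List A} (hw : w ≠ []) :
    mulLast F (a :: w) = mulLast (fun x => F (a :: x)) w := by
  simp [mulLast, hw]

lemma mulLast_append (F : List A → A) (w : List A) (a : A) :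
    mulLast F (w ++ [a]) = F w * a := by
  induction w generalizing F with
  | nil => simp [mulLast]
  | cons b w ih => simp [mulLast, ih]

lemma signedShuffle_mulLast (F : List A → A) (a b : A) (u v : List A) :
    signedShuffle (mulLast F) (u ++ [a]) (v ++ [b]) =
      (-1) ^ (v.length + 1) * (signedShuffle F u (v ++ [b]) * a) +
        signedShuffle F (u ++ [a]) v * b := by
  have step (F : List A → A) (c : A) (u v : List A) (h : u ++ v ≠ []) :
      signedShuffle (fun w => mulLast F (c :: w)) u v =
        signedShuffle (mulLast fun w => F (c :: w)) u v :=
    signedShuffle_congr fun w hw => mulLast_cons (by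
      rintro rfl
      apply h
      simpa [eq_comm] using hw)
  induction F, u, v using signedShuffle.induct with
  | case1 F v =>
    induction v generalizing F with
    | nil =>
      simp [signedShuffle, mulLast]
      ring
    | cons c v ih =>
      have h := ih (fun w => F (c :: w))
      simp only [List.nil_append, List.cons_append] at h ⊢
      rw [signedShuffle_cons_cons (mulLast _), step _ _ _ _ (by simp), step _ _ _ _ (by simp), h]
      simp only [signedShuffle, ← List.cons_append, mulLast_append]
      simp
      ring
  | case2 F c u =>
    induction u generalizing F c with
    | nil =>
      simp [signedShuffle, mulLast]
      ring
    | cons d u ih =>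
      have h := ih (fun w => F (c :: w)) d
      simp only [List.nil_append, List.cons_append] at h ⊢
      rw [signedShuffle_cons_cons (mulLast _), step _ _ _ _ (by simp), step _ _ _ _ (by simp), h]
      simp only [signedShuffle, signedShuffle_nil_right, ← List.cons_append, mulLast_append]
      simp
      ring
  | case3 F c u d v ih₁ ih₂ =>
    have h₁ := ih₁
    have h₂ := ih₂
    simp only [List.cons_append] at h₁ h₂ ⊢
    rw [signedShuffle_cons_cons (mulLast _), step _ _ _ _ (by simp), step _ _ _ _ (by simp), h₁, h₂]
    simp only [signedShuffle, List.length_append, List.length_cons, List.length_nil]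
    ring

/-- `σ` is increasing on the positions below `p` and on the remaining positions. -/
def IsShuffle {n : ℕ} (p : ℕ) (σ : Equiv.Perm (Fin n)) : Prop :=
  (∀ i j : Fin n, (i : ℕ) < p → (j : ℕ) < p → i < j → σ i < σ j) ∧
    (∀ i j : Fin n, p ≤ (i : ℕ) → p ≤ (j : ℕ) → i < j → σ i < σ j)

/-- The permutation sending `k` to `0` and `k.succAbove j` to `(e j).succ`. -/
def permSuccAbove {n : ℕ} (k : Fin (n + 1)) (e : Equiv.Perm (Fin n)) :
    Equiv.Perm (Fin (n + 1)) :=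
  Equiv.Perm.decomposeFin.symm (0, e) * k.cycleRange

section permSuccAbove

variable {n : ℕ} (k : Fin (n + 1)) (e : Equiv.Perm (Fin n))

@[simp]
lemma permSuccAbove_self : permSuccAbove k e k = 0 := by
  simp [permSuccAbove]

@[simp]
lemma permSuccAbove_succAbove (j : Fin n) :
    permSuccAbove k e (k.succAbove j) = (e j).succ := by
  simp [permSuccAbove]

@[simp]
lemma permSuccAbove_symm_zero : (permSuccAbove k e).symm 0 = k := by
  rw [Equiv.symm_apply_eq, permSuccAbove_self]

@[simp]
lemma permSuccAbove_symm_succ (j : Fin n) :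
    (permSuccAbove k e).symm j.succ = k.succAbove (e.symm j) := by
  rw [Equiv.symm_apply_eq, permSuccAbove_succAbove, Equiv.apply_symm_apply]

lemma sign_permSuccAbove :
    Equiv.Perm.sign (permSuccAbove k e) = (-1) ^ (k : ℕ) * Equiv.Perm.sign e := by
  simp [permSuccAbove, Equiv.Perm.sign_mul, mul_comm]

lemma permSuccAbove_bijective :
    Function.Bijective fun x : Fin (n + 1) × Equiv.Perm (Fin n) => permSuccAbove x.1 x.2 := by
  rw [Fintype.bijective_iff_injective_and_card]
  constructor
  · rintro ⟨k, e⟩ ⟨l, g⟩ h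
    simp only at h
    obtain rfl : k = l := by
      rw [← permSuccAbove_symm_zero k e, h, permSuccAbove_symm_zero]
    congr
    ext j : 1
    apply Fin.succ_injective
    rw [← permSuccAbove_succAbove k e, h, permSuccAbove_succAbove]
  · simp [Fintype.card_perm, Nat.factorial_succ]

lemma isShuffle_permSuccAbove_zero (p : ℕ) :
    IsShuffle (p + 1) (permSuccAbove 0 e) ↔ IsShuffle p e := by
  have hs (j : Fin n) : permSuccAbove 0 e j.succ = (e j).succ := by
    simpa using permSuccAbove_succAbove 0 e j
  simp only [IsShuffle, Fin.forall_fin_succ, permSuccAbove_self, hs, Fin.succ_lt_succ_iff,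
    Fin.val_succ, Nat.add_lt_add_iff_right, Nat.add_le_add_iff_right]
  simp

lemma isShuffle_permSuccAbove_self :
    IsShuffle k (permSuccAbove k e) ↔ IsShuffle k e := by
  have hlt (j : Fin n) : (k.succAbove j : ℕ) < k ↔ (j : ℕ) < k := by
    rw [← Fin.lt_def, Fin.succAbove_lt_iff_castSucc_lt, Fin.lt_def, Fin.val_castSucc]
  have hle (j : Fin n) : (k : ℕ) ≤ (k.succAbove j : ℕ) ↔ (k : ℕ) ≤ j := by
    simpa using (hlt j).not
  have hlt' (j : Fin n) : k < k.succAbove j ↔ (k : ℕ) ≤ j := by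
    rw [Fin.lt_succAbove_iff_le_castSucc, Fin.le_def, Fin.val_castSucc]
  have hgt' (j : Fin n) : k.succAbove j < k ↔ (j : ℕ) < k := by
    rw [Fin.lt_def, hlt]
  simp only [IsShuffle, Fin.forall_iff_succAbove k, permSuccAbove_self, hlt, hle, hlt', hgt',
    permSuccAbove_succAbove, Fin.succ_lt_succ_iff, Fin.succAbove_lt_succAbove_iff]
  simp

lemma not_isShuffle_permSuccAbove {p : ℕ} (h0 : k ≠ 0) (hp : (k : ℕ) ≠ p) :
    ¬ IsShuffle p (permSuccAbove k e) := by
  rintro ⟨h₁, h₂⟩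
  rcases lt_or_gt_of_ne hp with h | h
  · have := h₁ 0 k (by simp; omega) h (Fin.pos_of_ne_zero h0)
    simp at this
  · have := h₂ ⟨p, by omega⟩ k le_rfl h.le (by simpa [Fin.lt_def] using h)
    simp at this

end permSuccAbove

open Classical in
/-- The signed sum of `F` over the rearrangements of `w` by shuffle permutations. -/
noncomputable def permShuffle (F : List A → A) (p : ℕ) {n : ℕ} (w : Fin n → A) : A :=
  ∑ σ : Equiv.Perm (Fin n), if IsShuffle p σ then
    ((Equiv.Perm.sign σ : ℤ) : A) * F (List.ofFn fun i => w (σ⁻¹ i)) else 0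

lemma permShuffle_of_unique {F : List A → A} {p n : ℕ} {w : Fin n → A}
    (h : p = 0 ∨ n ≤ p) : permShuffle F p w = F (List.ofFn w) := by
  rw [permShuffle, Finset.sum_eq_single 1]
  · simp [IsShuffle]
  · intro σ _ hσ
    rw [if_neg]
    rintro ⟨h₁, h₂⟩
    apply hσ
    have hm : StrictMono σ := fun i j hij => by
      rcases h with h | h
      · exact h₂ i j (by omega) (by omega) hij
      · exact h₁ i j (by omega) (by omega) hij
    ext i : 1
    simpa using DFunLike.congr_fun
      (Subsingleton.elim (hm.orderIsoOfSurjective σ σ.surjective) (OrderIso.refl _)) i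
  · simp

open Classical in
lemma permShuffle_succ (F : List A → A) (p n : ℕ) (w : Fin (n + 1) → A) (k : Fin (n + 1))
    (hk : k ≠ 0) (hp : (k : ℕ) = p + 1) :
    permShuffle F (p + 1) w =
      permShuffle (fun x => F (w 0 :: x)) p (fun i => w i.succ) +
        (-1) ^ (p + 1) * permShuffle (fun x => F (w k :: x)) (p + 1)
          (fun i => w (k.succAbove i)) := by
  rw [permShuffle, ← (permSuccAbove_bijective (n := n)).sum_comp, Fintype.sum_prod_type,
    Finset.sum_eq_add (0 : Fin (n + 1)) k hk.symm]
  · congr 1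
    · refine Finset.sum_congr rfl fun e _ => ?_
      simp [isShuffle_permSuccAbove_zero, sign_permSuccAbove, List.ofFn_succ]
    · rw [permShuffle, Finset.mul_sum]
      refine Finset.sum_congr rfl fun e _ => ?_
      rw [← hp]
      simp [isShuffle_permSuccAbove_self, sign_permSuccAbove, List.ofFn_succ, mul_assoc]
  · rintro l _ ⟨hl0, hlk⟩
    refine Finset.sum_eq_zero fun e _ => if_neg ?_
    exact not_isShuffle_permSuccAbove l e hl0 (by rw [← hp]; simpa [Fin.ext_iff] using hlk)
  · simp
  · simp

lemma permShuffle_eq_signedShuffle (F : List A → A) (u v : List A) {n : ℕ} (w : Fin n → A)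
    (hw : List.ofFn w = u ++ v) : permShuffle F u.length w = signedShuffle F u v := by
  induction F, u, v using signedShuffle.induct generalizing n with
  | case1 F v => rw [permShuffle_of_unique (by simp), signedShuffle, hw]; rfl
  | case2 F a u =>
    have hn := congrArg List.length hw
    simp at hn
    rw [permShuffle_of_unique (by simp [hn]), signedShuffle, hw, List.append_nil]
  | case3 F a u b v ih₁ ih₂ =>
    have hn := congrArg List.length hw
    simp at hn
    obtain ⟨m, rfl⟩ : ∃ m, n = m + 1 := ⟨u.length + (v.length + 1), by omega⟩
    have hg (i : ℕ) (hi : i < m + 1) : w ⟨i, hi⟩ = ((a :: u) ++ (b :: v))[i]'(by simp; omega) := by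
      simp only [← hw, List.getElem_ofFn]
    have hk : u.length + 1 < m + 1 := by omega
    have h0 : w 0 = a := hg 0 (by omega)
    have hb : w ⟨u.length + 1, hk⟩ = b := by rw [hg]; simp
    rw [List.length_cons, permShuffle_succ F _ _ w ⟨u.length + 1, hk⟩ (by simp [Fin.ext_iff]) rfl,
      signedShuffle_cons_cons, h0, hb, ih₁]
    · congr 2
      apply ih₂
      apply List.ext_getElem
      · simp; omega
      · intro i h₁ h₂
        simp only [List.getElem_ofFn]
        by_cases hi : i < u.length + 1
        · rw [Fin.succAbove_of_castSucc_lt _ _ (by simpa [Fin.lt_def] using hi)]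
          simp only [Fin.castSucc_mk]
          rw [hg, List.getElem_append_left (by simpa using hi),
            List.getElem_append_left (by simpa using hi)]
        · rw [Fin.succAbove_of_le_castSucc _ _ (by simpa [Fin.le_def] using hi)]
          simp only [Fin.succ_mk]
          rw [hg, List.getElem_append_right (by simp; omega),
            List.getElem_append_right (by simp; omega)]
          have : i + 1 - (a :: u).length = (i - (a :: u).length) + 1 := by simp; omega
          simp only [this, List.getElem_cons_succ]
    · rw [List.ofFn_succ] at hw
      simpa using (List.cons.inj hw).2

lemma vanishesOnShuffles_iff (n : ℕ) (g : (ℕ → A) → A) (F : List A → A)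
    (hF : ∀ a, g a = F (List.ofFn fun i : Fin n => a i)) :
    VanishesOnShuffles n g ↔ ∀ u v : List A, u ≠ [] → v ≠ [] → u.length + v.length = n →
      signedShuffle F u v = 0 := by
  have hsum (p : ℕ) (a : ℕ → A) :
      ∑ σ ∈ Finset.univ.filter (fun σ : Equiv.Perm (Fin n) =>
        (∀ i j : Fin n, (i : ℕ) < p → (j : ℕ) < p → i < j → σ i < σ j) ∧
        (∀ i j : Fin n, p ≤ (i : ℕ) → p ≤ (j : ℕ) → i < j → σ i < σ j)),
      ((Equiv.Perm.sign σ : ℤ)) • g (permuteArgs n σ a) =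
        permShuffle F p (fun i : Fin n => a i) := by
    classical
    rw [permShuffle, Finset.sum_filter]
    refine Finset.sum_congr rfl fun σ _ => ?_
    simp [hF, permuteArgs, IsShuffle]
    congr
  constructor
  · intro h u v hu hv hn
    rw [← permShuffle_eq_signedShuffle F u v (fun i : Fin n => (u ++ v).getD i 0),
      ← hsum _ fun i => (u ++ v).getD i 0]
    · exact h _ _ hn (List.length_pos_iff.2 hu) (List.length_pos_iff.2 hv) _
    · apply List.ext_getElem <;> simp [hn]
  · intro h p q hn hp hq a
    have hw : (List.ofFn fun i : Fin n => a i) =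
        (List.ofFn fun i : Fin p => a i) ++ List.ofFn fun i : Fin q => a (p + i) := by
      subst hn
      simp [List.ofFn_add]
    rw [hsum]
    have := permShuffle_eq_signedShuffle F _ _ _ hw
    rw [List.length_ofFn] at this
    rw [this]
    exact h _ _ (by simp; omega) (by simp; omega) (by simpa using hn)

lemma barDiff_ofFn (F : List A → A) (n : ℕ) (a : ℕ → A) :
    barDiff F (List.ofFn fun i : Fin (n + 1) => a i) =
      ∑ i ∈ Finset.range n, (-1) ^ i * F (List.ofFn fun j : Fin n =>
        if (j : ℕ) < i then a j else if (j : ℕ) = i then a i * a (i + 1) else a (j + 1)) := by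
  induction n generalizing F a with
  | zero => simp [barDiff, mulHead]
  | succ n ih =>
    have h := ih (fun x => F (a 0 :: x)) (fun i => a (i + 1))
    rw [List.ofFn_succ, barDiff, Finset.sum_range_succ']
    simp only [Fin.val_succ, Fin.val_zero] at h ⊢
    rw [h, List.ofFn_succ, mulHead, sub_eq_add_neg, add_comm, ← Finset.sum_neg_distrib]
    congr 1
    · refine Finset.sum_congr rfl fun i _ => ?_
      rw [List.ofFn_succ]
      simp [pow_succ]
    · rw [List.ofFn_succ]
      simp

/-- The product of the first entry of a list with `F` at the remaining entries. -/
def mulFirst (F : List A → A) : List A → A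
  | [] => 0
  | a :: w => a * F w

/-- The Hochschild differential of an `n`-cochain, viewed as a function on lists. -/
def listDiff (n : ℕ) (F : List A → A) (w : List A) : A :=
  mulFirst F w - barDiff F w + (-1) ^ (n + 1) * mulLast F w

lemma hochδ_eq_listDiff (n : ℕ) (g : (ℕ → A) → A) (F : List A → A)
    (hF : ∀ a, g a = F (List.ofFn fun i : Fin n => a i)) (a : ℕ → A) :
    hochδ n g a = listDiff n F (List.ofFn fun i : Fin (n + 1) => a i) := by
  have hfirst : mulFirst F (List.ofFn fun i : Fin (n + 1) => a i) =
      a 0 * g fun i => a (i + 1) := by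
    rw [List.ofFn_succ, mulFirst, hF]; simp
  have hlast : mulLast F (List.ofFn fun i : Fin (n + 1) => a i) = g a * a n := by
    rw [List.ofFn_succ', List.concat_eq_append, mulLast_append, hF]; simp
  simp only [listDiff, hfirst, hlast, barDiff_ofFn, hochδ, sub_eq_add_neg,
    ← Finset.sum_neg_distrib]
  congr 1
  · congr 1
    refine Finset.sum_congr rfl fun i _ => ?_
    rw [hF]
    simp [zsmul_eq_mul, pow_succ]
  · simp [zsmul_eq_mul]

lemma signedShuffle_mulFirst (F : List A → A) (a b : A) (u v : List A) :
    signedShuffle (mulFirst F) (a :: u) (b :: v) =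
      a * signedShuffle F u (b :: v) +
        (-1) ^ (u.length + 1) * (b * signedShuffle F (a :: u) v) := by
  have h (c : A) (u v : List A) :
      signedShuffle (fun w => mulFirst F (c :: w)) u v = c * signedShuffle F u v := by
    simpa [mulFirst] using signedShuffle_linear c 0 F F u v
  rw [signedShuffle_cons_cons, h, h]

lemma signedShuffle_listDiff (n : ℕ) (F : List A → A) (u v : List A) :
    signedShuffle (listDiff n F) u v =
      signedShuffle (mulFirst F) u v - signedShuffle (barDiff F) u v +
        (-1) ^ (n + 1) * signedShuffle (mulLast F) u v := by
  have h₁ := signedShuffle_linear 1 (-1) (mulFirst F) (barDiff F) u v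
  have h₂ := signedShuffle_linear 1 ((-1) ^ (n + 1))
    (fun w => 1 * mulFirst F w + -1 * barDiff F w) (mulLast F) u v
  simp only [one_mul, neg_one_mul, ← sub_eq_add_neg] at h₁ h₂
  rw [← h₁, ← h₂]
  rfl

/-- If `F` vanishes on shuffles of total length `n`, the outer terms of its differential
cancel. -/
lemma signedShuffle_outer (n : ℕ) (F : List A → A)
    (h : ∀ u v : List A, u ≠ [] → v ≠ [] → u.length + v.length = n → signedShuffle F u v = 0)
    (u v : List A) (hu : u ≠ []) (hv : v ≠ []) (hn : u.length + v.length = n + 1) :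
    signedShuffle (mulFirst F) u v + (-1) ^ (n + 1) * signedShuffle (mulLast F) u v = 0 := by
  have hfirst : signedShuffle (mulFirst F) u v =
      u.head hu * signedShuffle F u.tail v +
        (-1) ^ u.length * (v.head hv * signedShuffle F u v.tail) := by
    obtain ⟨a, u, rfl⟩ := List.exists_cons_of_ne_nil hu
    obtain ⟨b, v, rfl⟩ := List.exists_cons_of_ne_nil hv
    exact signedShuffle_mulFirst F a b u v
  have hlast : signedShuffle (mulLast F) u v =
      (-1) ^ v.length * (signedShuffle F u.dropLast v * u.getLast hu) +
        signedShuffle F u v.dropLast * v.getLast hv := by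
    have := signedShuffle_mulLast F (u.getLast hu) (v.getLast hv) u.dropLast v.dropLast
    rw [List.dropLast_append_getLast, List.dropLast_append_getLast] at this
    rw [this, List.length_dropLast, Nat.sub_add_cancel (List.length_pos_iff.2 hv)]
  have hs (k : ℕ) : ((-1 : A) ^ k) * (-1) ^ k = 1 := by rw [← mul_pow]; simp
  have hleft : u.head hu * signedShuffle F u.tail v +
      (-1) ^ (n + 1) * ((-1) ^ v.length * (signedShuffle F u.dropLast v * u.getLast hu)) = 0 := by
    match u, hu with
    | [a], _ =>
      obtain rfl : v.length = n := by simp at hn; omega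
      simp only [List.head_cons, List.tail_cons, List.dropLast_singleton, List.getLast_singleton,
        signedShuffle, pow_succ]
      linear_combination (-(F v * a)) * hs v.length
    | a :: c :: u, _ =>
      rw [h _ v (by simp) hv (by simp at hn ⊢; omega), h _ v (by simp) hv (by simp at hn ⊢; omega)]
      simp
  have hright : (-1) ^ u.length * (v.head hv * signedShuffle F u v.tail) +
      (-1) ^ (n + 1) * (signedShuffle F u v.dropLast * v.getLast hv) = 0 := by
    match v, hv with
    | [b], _ =>
      obtain rfl : u.length = n := by simp at hn; omega
      simp only [List.head_cons, List.tail_cons, List.dropLast_singleton, List.getLast_singleton,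
        signedShuffle_nil_right, pow_succ]
      ring
    | b :: d :: v, _ =>
      rw [h u _ hu (by simp) (by simp at hn ⊢; omega), h u _ hu (by simp) (by simp at hn ⊢; omega)]
      simp
  rw [hfirst, hlast]
  linear_combination hleft + hright

/-- Harrison cochains form a subcomplex of the Hochschild cochain complex of a
commutative algebra: if an `n`-cochain `f` vanishes on shuffles, so does `δf`. -/
theorem harrison_subcomplex_of_hochschild (n : ℕ) (hn : 1 ≤ n)
    (f : MultilinearMap R (fun _ : Fin n => A) A)
    (hf : VanishesOnShuffles n (toC f)) :
    VanishesOnShuffles (n + 1) (hochδ n (toC f)) := by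
  obtain ⟨F, hF⟩ : ∃ F : List A → A, ∀ a, toC f a = F (List.ofFn fun i : Fin n => a i) :=
    ⟨fun l => f fun i => l.getD i 0, by simp [toC]⟩
  rw [vanishesOnShuffles_iff n _ F hF] at hf
  rw [vanishesOnShuffles_iff (n + 1) _ _ (hochδ_eq_listDiff n _ F hF)]
  intro u v hu hv hn
  rw [signedShuffle_listDiff, signedShuffle_barDiff,
    barDiff_eq_zero fun x hx hxu => hf x v hx hv (by omega),
    barDiff_eq_zero fun y hy hyv => hf u y hu hy (by omega)]
  linear_combination signedShuffle_outer n F hf u v hu hv hn
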